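/- For every nonzero polynomial u ∈ F_11[X] of degree n, the number of indices t with n ≤ t ≤ n+5 for which the coefficient of X^t in u·g1 is nonzero, plus the number of indices t with n ≤ t ≤ n+5 for which the coefficient of X^t in u·g2 is nonzero, is at least 6. (The truncation of the codeword v(D) = u(D)·G(D) to the final time window [n, n+5] has Hamming weight at least 6.) -/

import Mathlib

open Polynomial

/-- The indicator of a nonzero field element. -/
def hammingIndicator (x : ZMod 11) : ℕ := if x = 0 then 0 else 1

/-- The combined weight of an output symbol pair `a ± b`. -/
def pairWeight (a b : ZMod 11) : ℕ := hammingIndicator (a + b) + hammingIndicator (a - b)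

/-- Nonzero inputs have truncated weight at least `6`; the intermediate bounds prune the search. -/
theorem pairWeight_pruned_search :
    ∀ a : ZMod 11, a ≠ 0 →
    ∀ b, pairWeight (8 * b) (5 * a) < 4 →
    ∀ c, pairWeight (8 * b) (5 * a) + pairWeight (8 * c + a) (5 * b) < 4 →
    ∀ d, pairWeight (8 * b) (5 * a) + pairWeight (8 * c + a) (5 * b)
        + pairWeight (8 * d + b + a) (5 * c) < 4 →
    ∀ e, pairWeight (8 * b) (5 * a) + pairWeight (8 * c + a) (5 * b)
        + pairWeight (8 * d + b + a) (5 * c)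
        + pairWeight (8 * e + c + b) (5 * d + 5 * a) < 4 →
    ∀ f, ¬ pairWeight (8 * b) (5 * a) + pairWeight (8 * c + a) (5 * b)
        + pairWeight (8 * d + b + a) (5 * c)
        + pairWeight (8 * e + c + b) (5 * d + 5 * a)
        + pairWeight (8 * f + d + c + 8 * a) (5 * e + 5 * b) < 4 := by
  decide +kernel

theorem two_le_pairWeight (a : ZMod 11) (ha : a ≠ 0) : 2 ≤ pairWeight (8 * a) 0 := by
  revert a
  decide +kernel

theorem four_le_sum_pairWeight (a b c d e f : ZMod 11) (ha : a ≠ 0) :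
    4 ≤ pairWeight (8 * b) (5 * a) + pairWeight (8 * c + a) (5 * b)
        + pairWeight (8 * d + b + a) (5 * c)
        + pairWeight (8 * e + c + b) (5 * d + 5 * a)
        + pairWeight (8 * f + d + c + 8 * a) (5 * e + 5 * b) := by
  by_contra h
  exact pairWeight_pruned_search a ha b (by omega) c (by omega) d (by omega) e (by omega) f
    (by omega)

theorem coeff_mul_X_pow_add_eq {R : Type*} [Semiring R] (u : R[X]) (n k r m : ℕ) (hm : m ≤ r) :
    (u * X ^ m).coeff (n + k) = (u * X ^ r).coeff (n + (k + (r - m))) := by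
  obtain ⟨s, rfl⟩ := Nat.exists_eq_add_of_le hm
  rw [pow_add, ← mul_assoc, Nat.add_sub_cancel_left, ← add_assoc n k s, coeff_mul_X_pow]

theorem coeff_mul_palindromic_quintic (p q : ZMod 11) (u : (ZMod 11)[X]) (n k : ℕ) :
    (u * (C p + C q * X + X ^ 2 + X ^ 3 + C q * X ^ 4 + C p * X ^ 5)).coeff (n + k) =
      p * (u * X ^ 5).coeff (n + (k + 5)) + q * (u * X ^ 5).coeff (n + (k + 4)) +
      (u * X ^ 5).coeff (n + (k + 3)) + (u * X ^ 5).coeff (n + (k + 2)) +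
      q * (u * X ^ 5).coeff (n + (k + 1)) + p * (u * X ^ 5).coeff (n + k) := by
  have h : u * (C p + C q * X + X ^ 2 + X ^ 3 + C q * X ^ 4 + C p * X ^ 5) =
      C p * (u * X ^ 0) + C q * (u * X ^ 1) + u * X ^ 2 + u * X ^ 3 + C q * (u * X ^ 4)
        + C p * (u * X ^ 5) := by ring
  rw [h]
  simp only [coeff_add, coeff_C_mul]
  rw [coeff_mul_X_pow_add_eq u n k 5 0 (by norm_num),
    coeff_mul_X_pow_add_eq u n k 5 1 (by norm_num),
    coeff_mul_X_pow_add_eq u n k 5 2 (by norm_num),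
    coeff_mul_X_pow_add_eq u n k 5 3 (by norm_num),
    coeff_mul_X_pow_add_eq u n k 5 4 (by norm_num)]

theorem card_filter_coeff_ne_zero (v : (ZMod 11)[X]) (n : ℕ) :
    ((Finset.Icc n (n + 5)).filter (fun t => v.coeff t ≠ 0)).card =
      ∑ i ∈ Finset.range 6, hammingIndicator (v.coeff (n + i)) := by
  rw [Finset.card_filter, ← Finset.Ico_add_one_right_eq_Icc, Finset.sum_Ico_eq_sum_range,
    show n + 5 + 1 - n = 6 by omega]
  simp only [hammingIndicator, ne_eq, ite_not]

theorem stmt14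
    (g1 g2 : Polynomial (ZMod 11))
    (hg1 : g1 = C 8 + C 5 * X + X ^ 2 + X ^ 3 + C 5 * X ^ 4 + C 8 * X ^ 5)
    (hg2 : g2 = C 8 + C 6 * X + X ^ 2 + X ^ 3 + C 6 * X ^ 4 + C 8 * X ^ 5) :
    ∀ u : Polynomial (ZMod 11), u ≠ 0 →
      6 ≤ ((Finset.Icc u.natDegree (u.natDegree + 5)).filter
              (fun t => (u * g1).coeff t ≠ 0)).card +
          ((Finset.Icc u.natDegree (u.natDegree + 5)).filter
              (fun t => (u * g2).coeff t ≠ 0)).card := by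
  intro u hu
  subst hg1 hg2
  have hlead : (u * X ^ 5).coeff (u.natDegree + 5) ≠ 0 := by
    rw [coeff_mul_X_pow]
    exact leadingCoeff_ne_zero.mpr hu
  have hzero (s : ℕ) : (u * X ^ 5).coeff (u.natDegree + (s + 6)) = 0 := by
    rw [show u.natDegree + (s + 6) = u.natDegree + s + 1 + 5 by ring, coeff_mul_X_pow]
    exact coeff_eq_zero_of_natDegree_lt (by omega)
  have h6 := hzero 0
  have h7 := hzero 1
  have h8 := hzero 2
  have h9 := hzero 3
  have h10 := hzero 4
  rw [card_filter_coeff_ne_zero, card_filter_coeff_ne_zero]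
  simp only [Finset.sum_range_succ, Finset.sum_range_zero, coeff_mul_palindromic_quintic,
    Nat.reduceAdd, zero_add] at h6 h7 h8 h9 h10 ⊢
  rw [h6, h7, h8, h9, h10]
  generalize (u * X ^ 5).coeff (u.natDegree + 5) = a at *
  generalize (u * X ^ 5).coeff (u.natDegree + 4) = b
  generalize (u * X ^ 5).coeff (u.natDegree + 3) = c
  generalize (u * X ^ 5).coeff (u.natDegree + 2) = d
  generalize (u * X ^ 5).coeff (u.natDegree + 1) = e
  generalize (u * X ^ 5).coeff (u.natDegree + 0) = f
  have hlow := two_le_pairWeight a hlead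
  have hrest := four_le_sum_pairWeight a b c d e f hlead
  have hneg : (6 : ZMod 11) = -5 := by decide
  simp only [pairWeight] at hlow hrest
  rw [hneg]
  ring_nf at hlow hrest ⊢
  omega
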